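/- arXiv:1205.2334 — 3 statements merged into one kernel-verified Lean document; each statement's English description precedes it below -/
import Mathlib

section
/- Let x* be a local minimizer of the problem (P2): minimize f(x) + ν‖x_J‖₀ over x in X subject to g(x) ≤ 0 componentwise and h(x) = 0, where ν ≥ 0. Let J* = {j ∈ J : x*_j ≠ 0} and J̄* = J \ J*. Suppose Robinson's condition holds at x* relative to J̄*, namely: for every (a, b, c) in ℝ^m × ℝ^p × ℝ^{J̄*} there exist a vector d in the tangent cone T_X(x*) and a vector v in ℝ^m with v_i ≤ 0 for every index i with g_i(x*) = 0, such that g'(x*)d − v = a, h'(x*)d = b, and the subvector of d indexed by J̄* equals c. Then there exists (λ*, μ*, z*) in ℝ^m × ℝ^p × ℝ^n such that: (i) −∇f(x*) − Σ_i λ*_i ∇g_i(x*) − Σ_j μ*_j ∇h_j(x*) − z* lies in the normal cone N_X(x*); (ii) λ*_i ≥ 0 and λ*_i g_i(x*) = 0 for i = 1, …, m; and (iii) z*_j = 0 for every j not in J̄*. -/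
open Finset

theorem hasDerivAt_max_zero_sq (t : ℝ) :
    HasDerivAt (fun s : ℝ => max s 0 ^ 2) (2 * max t 0) t := by
  rcases lt_trichotomy t 0 with ht | rfl | ht
  · rw [max_eq_right ht.le, mul_zero]
    refine (hasDerivAt_const t (0 : ℝ)).congr_of_eventuallyEq ?_
    filter_upwards [eventually_lt_nhds ht] with s hs
    simp [max_eq_right hs.le]
  · rw [max_self, mul_zero, hasDerivAt_iff_isLittleO_nhds_zero]
    have h2 : (fun s : ℝ => s ^ 2) =o[nhds 0] fun s : ℝ => s := by
      simpa using Asymptotics.isLittleO_pow_id (𝕜 := ℝ) one_lt_two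
    refine Asymptotics.IsBigO.trans_isLittleO (Asymptotics.IsBigO.of_bound 1 ?_) h2
    refine Filter.Eventually.of_forall fun s => ?_
    rcases le_total s 0 with hs | hs <;> simp [hs, sq_nonneg]
  · rw [max_eq_left ht.le]
    refine HasDerivAt.congr_of_eventuallyEq (f := fun s : ℝ => s ^ 2) ?_ ?_
    · simpa using hasDerivAt_pow 2 t
    filter_upwards [eventually_gt_nhds ht] with s hs
    simp [max_eq_left hs.le]

section FritzJohn

variable {E ι κ : Type*} [NormedAddCommGroup E] [NormedSpace ℝ E] [ProperSpace E]
  [Fintype ι] [Fintype κ]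

/-- Near a strict local minimizer, minimizers of the quadratic penalty functions satisfy
approximate Fritz John conditions. -/
theorem exists_approx_fritzJohn {X : Set E} (hXc : IsClosed X) (hX : Convex ℝ X)
    {f : E → ℝ} {g : ι → E → ℝ} {h : κ → E → ℝ}
    (hf : ContDiff ℝ 1 f) (hg : ∀ i, ContDiff ℝ 1 (g i)) (hh : ∀ j, ContDiff ℝ 1 (h j))
    {xs : E} (hxs : xs ∈ X) (hgs : ∀ i, g i xs ≤ 0) (hhs : ∀ j, h j xs = 0) {δ : ℝ} (hδ : 0 < δ)
    (hmin : ∀ x ∈ X, (∀ i, g i x ≤ 0) → (∀ j, h j x = 0) → ‖x - xs‖ < δ → x ≠ xs → f xs < f x)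
    {ε : ℝ} (hε : 0 < ε) :
    ∃ x ∈ X, ‖x - xs‖ < ε ∧ ∃ w : ℝ × (ι → ℝ) × (κ → ℝ), ‖w‖ = 1 ∧ 0 ≤ w.1 ∧
      (∀ i, 0 ≤ w.2.1 i) ∧ (∀ i, g i x < 0 → w.2.1 i = 0) ∧
      ∀ y ∈ X, 0 ≤ w.1 * fderiv ℝ f x (y - x) + ∑ i, w.2.1 i * fderiv ℝ (g i) x (y - x)
        + ∑ j, w.2.2 j * fderiv ℝ (h j) x (y - x) := by
  obtain ⟨r, hr0, hr⟩ := exists_between (lt_min hδ hε)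
  obtain ⟨hrδ, hrε⟩ := lt_min_iff.1 hr
  set P : E → ℝ := fun x => ∑ i, max (g i x) 0 ^ 2 + ∑ j, h j x ^ 2 with hP
  have hPc : Continuous P := by
    have := fun i => (hg i).continuous
    have := fun j => (hh j).continuous
    fun_prop
  have hfc := hf.continuous
  have hP0 : ∀ x, 0 ≤ P x := fun x => by positivity
  have hPs : P xs = 0 := by simp [hP, hgs, hhs]
  have hPfeas : ∀ x, P x = 0 → (∀ i, g i x ≤ 0) ∧ ∀ j, h j x = 0 := by
    intro x hx
    obtain ⟨h1, h2⟩ := (add_eq_zero_iff_of_nonneg (by positivity) (by positivity)).1 hx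
    rw [sum_eq_zero_iff_of_nonneg fun _ _ => by positivity] at h1 h2
    exact ⟨fun i => by simpa using h1 i (mem_univ i), fun j => by simpa using h2 j (mem_univ j)⟩
  have hS : IsCompact (X ∩ Metric.sphere xs r) := (isCompact_sphere xs r).inter_left hXc
  obtain ⟨k, hk⟩ : ∃ k : ℕ, X ∩ Metric.sphere xs r ⊆ {x | f xs < f x + k * P x} := by
    refine hS.elim_directed_cover (fun k : ℕ => {x | f xs < f x + k * P x})
      (fun k => isOpen_lt (by fun_prop) (by fun_prop)) ?_ ?_
    · rintro x ⟨hxX, hxr⟩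
      rw [mem_sphere_iff_norm] at hxr
      rw [Set.mem_iUnion]
      rcases (hP0 x).eq_or_lt with h0 | h0
      · obtain ⟨h1, h2⟩ := hPfeas x h0.symm
        refine ⟨0, ?_⟩
        have : x ≠ xs := by rintro rfl; simp at hxr; linarith
        simpa using hmin x hxX h1 h2 (hxr ▸ hrδ) this
      · obtain ⟨k, hk⟩ := exists_nat_gt ((f xs - f x) / P x)
        refine ⟨k, ?_⟩
        rw [div_lt_iff₀ h0] at hk
        simp only [Set.mem_ofPred_eq]
        linarith
    · refine Monotone.directed_le fun a b hab x hx => ?_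
      simp only [Set.mem_ofPred_eq] at hx ⊢
      have : (a : ℝ) ≤ b := by exact_mod_cast hab
      nlinarith [hP0 x]
  set F : E → ℝ := fun x => f x + k * P x with hF
  obtain ⟨x, ⟨hxX, hxr⟩, hxmin⟩ :=
    ((isCompact_closedBall xs r).inter_left hXc).exists_isMinOn (f := F)
      ⟨xs, hxs, Metric.mem_closedBall_self hr0.le⟩ (by fun_prop)
  have hxlt : ‖x - xs‖ < r := by
    rw [mem_closedBall_iff_norm] at hxr
    refine hxr.lt_of_ne fun he => ?_
    have h1 : f xs < F x := hk ⟨hxX, mem_sphere_iff_norm.2 he⟩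
    have h2 : F x ≤ F xs := hxmin ⟨hxs, Metric.mem_closedBall_self hr0.le⟩
    simp only [hF, hPs] at h1 h2
    linarith
  have hloc : IsLocalMinOn F X x := by
    have hb : Metric.ball xs r ∈ nhds x :=
      Metric.isOpen_ball.mem_nhds (mem_ball_iff_norm.2 hxlt)
    filter_upwards [self_mem_nhdsWithin, mem_nhdsWithin_of_mem_nhds hb] with y hyX hyb
    exact hxmin ⟨hyX, Metric.ball_subset_closedBall hyb⟩
  have hFd : HasFDerivAt F (fderiv ℝ f x + (k : ℝ) •
      (∑ i, (2 * max (g i x) 0) • fderiv ℝ (g i) x + ∑ j, (2 * h j x) • fderiv ℝ (h j) x)) x := by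
    have hd : ∀ {u : E → ℝ}, ContDiff ℝ 1 u → HasFDerivAt u (fderiv ℝ u x) x :=
      fun hu => (hu.differentiable one_ne_zero x).hasFDerivAt
    refine (hd hf).add (HasFDerivAt.const_mul (HasFDerivAt.add ?_ ?_) _)
    · exact HasFDerivAt.fun_sum fun i _ =>
        (hasDerivAt_max_zero_sq (g i x)).comp_hasFDerivAt x (hd (hg i))
    · refine HasFDerivAt.fun_sum fun j _ => ?_
      have hj : HasDerivAt (fun s : ℝ => s ^ 2) (2 * h j x) (h j x) := by
        simpa using hasDerivAt_pow 2 (h j x)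
      exact hj.comp_hasFDerivAt x (hd (hh j))
  set w : ℝ × (ι → ℝ) × (κ → ℝ) :=
    (1, fun i => k * (2 * max (g i x) 0), fun j => k * (2 * h j x)) with hw
  have hwn : 0 < ‖w‖ := norm_pos_iff.2 fun h0 => by simp [hw] at h0
  refine ⟨x, hxX, hxlt.trans hrε, ‖w‖⁻¹ • w, ?_, ?_, ?_, ?_, ?_⟩
  · rw [norm_smul, norm_inv, norm_norm, inv_mul_cancel₀ hwn.ne']
  · simp [hw]
  · intro i
    simp only [hw, Prod.smul_snd, Prod.smul_fst, Pi.smul_apply, smul_eq_mul]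
    positivity
  · intro i hi
    simp [hw, max_eq_right hi.le]
  · intro y hy
    have key := hloc.hasFDerivWithinAt_nonneg hFd.hasFDerivWithinAt
      (sub_mem_posTangentConeAt_of_segment_subset (hX.segment_subset hxX hy))
    refine (mul_nonneg (inv_nonneg.2 hwn.le) key).trans_eq ?_
    simp only [hw, Prod.smul_snd, Prod.smul_fst, Pi.smul_apply, smul_eq_mul, add_apply,
      smul_apply, _root_.sum_apply, mul_add, mul_sum, mul_assoc]
    ring

/-- Fritz John conditions at a strict local minimizer over a closed convex set. -/
theorem exists_fritzJohn {X : Set E} (hXc : IsClosed X) (hX : Convex ℝ X)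
    {f : E → ℝ} {g : ι → E → ℝ} {h : κ → E → ℝ}
    (hf : ContDiff ℝ 1 f) (hg : ∀ i, ContDiff ℝ 1 (g i)) (hh : ∀ j, ContDiff ℝ 1 (h j))
    {xs : E} (hxs : xs ∈ X) (hgs : ∀ i, g i xs ≤ 0) (hhs : ∀ j, h j xs = 0) {δ : ℝ} (hδ : 0 < δ)
    (hmin : ∀ x ∈ X, (∀ i, g i x ≤ 0) → (∀ j, h j x = 0) → ‖x - xs‖ < δ → x ≠ xs → f xs < f x) :
    ∃ w : ℝ × (ι → ℝ) × (κ → ℝ), w ≠ 0 ∧ 0 ≤ w.1 ∧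
      (∀ i, 0 ≤ w.2.1 i) ∧ (∀ i, g i xs < 0 → w.2.1 i = 0) ∧
      ∀ y ∈ X, 0 ≤ w.1 * fderiv ℝ f xs (y - xs) + ∑ i, w.2.1 i * fderiv ℝ (g i) xs (y - xs)
        + ∑ j, w.2.2 j * fderiv ℝ (h j) xs (y - xs) := by
  choose x _ hxs' w hw1 hw0 hwg hwc hwX using fun N : ℕ =>
    exists_approx_fritzJohn hXc hX hf hg hh hxs hgs hhs hδ hmin
      (ε := 1 / ((N : ℝ) + 1)) (by positivity)
  have hx : Filter.Tendsto x Filter.atTop (nhds xs) := by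
    rw [tendsto_iff_norm_sub_tendsto_zero]
    exact squeeze_zero (fun _ => norm_nonneg _) (fun N => (hxs' N).le)
      tendsto_one_div_add_atTop_nhds_zero_nat
  obtain ⟨v, hv, φ, hφ, hφv⟩ := (isCompact_sphere (0 : ℝ × (ι → ℝ) × (κ → ℝ)) 1).tendsto_subseq
    (x := w) fun N => by simpa using hw1 N
  have hxφ := hx.comp hφ.tendsto_atTop
  refine ⟨v, ?_, ?_, ?_, ?_, ?_⟩
  · rintro rfl
    simp at hv
  · exact ge_of_tendsto' ((continuous_fst.tendsto v).comp hφv) fun N => hw0 _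
  · intro i
    have hc : Continuous fun u : ℝ × (ι → ℝ) × (κ → ℝ) => u.2.1 i := by fun_prop
    exact ge_of_tendsto' ((hc.tendsto v).comp hφv) fun N => hwg _ i
  · intro i hi
    have hc : Continuous fun u : ℝ × (ι → ℝ) × (κ → ℝ) => u.2.1 i := by fun_prop
    refine tendsto_nhds_unique ((hc.tendsto v).comp hφv) (tendsto_const_nhds.congr' ?_)
    have := (((hg i).continuous.tendsto xs).comp hxφ).eventually (eventually_lt_nhds hi)
    filter_upwards [this] with N hN
    exact (hwc _ i hN).symm
  · intro y hy
    have hc : Continuous fun q : (ℝ × (ι → ℝ) × (κ → ℝ)) × E =>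
        q.1.1 * fderiv ℝ f q.2 (y - q.2) + ∑ i, q.1.2.1 i * fderiv ℝ (g i) q.2 (y - q.2)
          + ∑ j, q.1.2.2 j * fderiv ℝ (h j) q.2 (y - q.2) := by
      have := hf.continuous_fderiv one_ne_zero
      have := fun i => (hg i).continuous_fderiv one_ne_zero
      have := fun j => (hh j).continuous_fderiv one_ne_zero
      fun_prop
    exact ge_of_tendsto' ((hc.tendsto (v, xs)).comp (hφv.prodMk_nhds hxφ)) fun N => hwX _ y hy

end FritzJohn

/-- First-order necessary optimality conditions for the cardinality-penalized
problem (P2): `min f(x) + ν‖x_J‖₀` s.t. `x ∈ X`, `g(x) ≤ 0`, `h(x) = 0`. -/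
theorem first_order_necessary_P2
    {n m p : ℕ} (X : Set (Fin n → ℝ)) (hXclosed : IsClosed X) (hXconv : Convex ℝ X)
    (f : (Fin n → ℝ) → ℝ) (g : (Fin n → ℝ) → Fin m → ℝ) (h : (Fin n → ℝ) → Fin p → ℝ)
    (hf : ContDiff ℝ 1 f) (hg : ∀ i, ContDiff ℝ 1 fun x => g x i)
    (hh : ∀ j, ContDiff ℝ 1 fun x => h x j)
    (J : Finset (Fin n)) (ν : ℝ) (hν : 0 ≤ ν)
    (xs : Fin n → ℝ)
    -- gradients of f, g, h at x*
    (fgrad : Fin n → ℝ) (gJac : Fin m → Fin n → ℝ) (hJac : Fin p → Fin n → ℝ)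
    (hfd : HasFDerivAt f (∑ j, fgrad j • (ContinuousLinearMap.proj j : (Fin n → ℝ) →L[ℝ] ℝ)) xs)
    (hgd : ∀ i, HasFDerivAt (fun x => g x i)
      (∑ j, gJac i j • (ContinuousLinearMap.proj j : (Fin n → ℝ) →L[ℝ] ℝ)) xs)
    (hhd : ∀ i, HasFDerivAt (fun x => h x i)
      (∑ j, hJac i j • (ContinuousLinearMap.proj j : (Fin n → ℝ) →L[ℝ] ℝ)) xs)
    -- x* is a local minimizer of (P2)
    (hfeas : xs ∈ X ∧ (∀ i, g xs i ≤ 0) ∧ (∀ j, h xs j = 0))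
    (hlocmin : ∃ ε > 0, ∀ x, x ∈ X → (∀ i, g x i ≤ 0) → (∀ j, h x j = 0) →
      ‖x - xs‖ < ε →
        f xs + ν * ((J.filter fun j => xs j ≠ 0).card : ℝ) ≤
          f x + ν * ((J.filter fun j => x j ≠ 0).card : ℝ))
    -- J* = {j ∈ J : x*_j ≠ 0}, J̄* = J \ J*
    (Jstar : Finset (Fin n)) (hJstar : Jstar = J.filter fun j => xs j ≠ 0)
    -- Robinson's condition at x* relative to J̄* = J \ J*
    (hRobinson : ∀ (a : Fin m → ℝ) (b : Fin p → ℝ) (c : Fin n → ℝ),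
      ∃ d ∈ closure {d : Fin n → ℝ | ∃ t : ℝ, 0 ≤ t ∧ ∃ x ∈ X, d = t • (x - xs)},
        ∃ v : Fin m → ℝ, (∀ i, g xs i = 0 → v i ≤ 0) ∧
          (∀ i, (∑ j, gJac i j * d j) - v i = a i) ∧
          (∀ i, (∑ j, hJac i j * d j) = b i) ∧
          (∀ j ∈ J \ Jstar, d j = c j)) :
    ∃ (lam : Fin m → ℝ) (mu : Fin p → ℝ) (z : Fin n → ℝ),
      (∀ x ∈ X, ∑ j, (-(fgrad j) - (∑ i, lam i * gJac i j) - (∑ i, mu i * hJac i j) - z j)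
          * (x j - xs j) ≤ 0) ∧
      (∀ i, 0 ≤ lam i ∧ lam i * g xs i = 0) ∧
      (∀ j, j ∉ J \ Jstar → z j = 0) := by
  obtain ⟨hxX, hgx, hhx⟩ := hfeas
  obtain ⟨ε, hε, hloc⟩ := hlocmin
  have happ : ∀ (a d : Fin n → ℝ),
      (∑ j, a j • (ContinuousLinearMap.proj j : (Fin n → ℝ) →L[ℝ] ℝ)) d = ∑ j, a j * d j := by
    intro a d
    simp
  have hq : HasFDerivAt (fun x : Fin n → ℝ => ∑ j, (x j - xs j) ^ 2)
      (0 : (Fin n → ℝ) →L[ℝ] ℝ) xs := by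
    have h1 : ∀ j, HasFDerivAt (fun x : Fin n → ℝ => (x j - xs j) ^ 2)
        (0 : (Fin n → ℝ) →L[ℝ] ℝ) xs := fun j => by
      simpa using ((hasFDerivAt_apply (𝕜 := ℝ) j xs).sub_const (xs j)).pow 2
    simpa using HasFDerivAt.fun_sum (u := univ) fun j _ => h1 j
  -- `x_{J̄*} = 0` becomes a family of equality constraints, and a quadratic term makes the
  -- minimizer strict.
  obtain ⟨w, hw, hw0, hwg, hwc, hwX⟩ := exists_fritzJohn hXclosed hXconv
    (f := fun x => f x + ∑ j, (x j - xs j) ^ 2) (g := fun i x => g x i)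
    (h := Sum.elim (fun j x => h x j) fun (j : (J \ Jstar : Finset (Fin n))) x => x j)
    (hf.add (by fun_prop)) hg
    (by rintro (j | j) <;> [exact hh j; exact contDiff_apply ℝ ℝ _])
    hxX hgx
    (by
      rintro (j | ⟨j, hj⟩)
      · exact hhx j
      · simp only [hJstar, mem_sdiff, mem_filter, not_and, not_not] at hj
        exact hj.2 hj.1)
    hε
    (by
      intro x hx hgx' hhx' hxε hne
      have h1 := hloc x hx hgx' (fun j => hhx' (.inl j)) hxε
      have h2 : (J.filter fun j => x j ≠ 0) ⊆ J.filter fun j => xs j ≠ 0 := by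
        intro j hj
        by_contra hj'
        rw [← hJstar] at hj'
        exact (mem_filter.1 hj).2 (hhx' (.inr ⟨j, mem_sdiff.2 ⟨(mem_filter.1 hj).1, hj'⟩⟩))
      have h3 : ((J.filter fun j => x j ≠ 0).card : ℝ) ≤ (J.filter fun j => xs j ≠ 0).card := by
        exact_mod_cast card_le_card h2
      have h4 := mul_le_mul_of_nonneg_left h3 hν
      obtain ⟨j, hj⟩ := Function.ne_iff.1 hne
      have h5 : 0 < ∑ j, (x j - xs j) ^ 2 :=
        sum_pos' (fun _ _ => sq_nonneg _) ⟨j, mem_univ j, sq_pos_of_ne_zero (sub_ne_zero.2 hj)⟩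
      simp only [sub_self, ne_eq, OfNat.ofNat_ne_zero, not_false_eq_true, zero_pow, sum_const_zero]
      linarith)
  obtain ⟨w0, lam, mu⟩ := w
  simp only at hw0 hwg hwc hwX
  have hF : fderiv ℝ (fun x => f x + ∑ j, (x j - xs j) ^ 2) xs =
      ∑ j, fgrad j • (ContinuousLinearMap.proj j : (Fin n → ℝ) →L[ℝ] ℝ) := by
    simpa using (hfd.fun_add hq).fderiv
  have hproj : ∀ j : Fin n, fderiv ℝ (fun x : Fin n → ℝ => x j) xs = ContinuousLinearMap.proj j :=
    fun j => (hasFDerivAt_apply j xs).fderiv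
  simp only [hF, fun i => (hgd i).fderiv, Fintype.sum_sum_type, Sum.elim_inl, Sum.elim_inr,
    fun i => (hhd i).fderiv, happ, hproj, ContinuousLinearMap.proj_apply, Pi.sub_apply] at hwX
  -- The Fritz John inequality extends to the tangent cone.
  have hT : ∀ d ∈ closure {d : Fin n → ℝ | ∃ t : ℝ, 0 ≤ t ∧ ∃ x ∈ X, d = t • (x - xs)},
      0 ≤ w0 * ∑ j, fgrad j * d j + ∑ i, lam i * ∑ j, gJac i j * d j
        + (∑ i, mu (.inl i) * ∑ j, hJac i j * d j
          + ∑ j : (J \ Jstar : Finset (Fin n)), mu (.inr j) * d j) := by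
    have hcl : IsClosed {d : Fin n → ℝ | 0 ≤ w0 * ∑ j, fgrad j * d j
        + ∑ i, lam i * ∑ j, gJac i j * d j + (∑ i, mu (.inl i) * ∑ j, hJac i j * d j
          + ∑ j : (J \ Jstar : Finset (Fin n)), mu (.inr j) * d j)} :=
      isClosed_le continuous_const (by fun_prop)
    refine fun d hd => closure_minimal ?_ hcl hd
    rintro _ ⟨t, ht, x, hx, rfl⟩
    refine (mul_nonneg ht (hwX x hx)).trans_eq ?_
    simp only [Pi.smul_apply, Pi.sub_apply, smul_eq_mul, mul_add, mul_sum, mul_left_comm _ t]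
  have hw0' : 0 < w0 := by
    refine hw0.lt_of_ne fun h0 => hw ?_
    obtain ⟨d, hd, v, hv, hvg, hvh, hvz⟩ := hRobinson (fun i => -lam i)
      (fun i => -mu (.inl i))
      (fun j => if hj : j ∈ J \ Jstar then -mu (.inr ⟨j, hj⟩) else 0)
    have h1 := hT d hd
    have h2 : ∀ j : (J \ Jstar : Finset (Fin n)), d j = -mu (.inr j) := fun j => by
      rw [hvz j j.2, dif_pos j.2]
    have h3 : ∀ i, lam i * ∑ j, gJac i j * d j ≤ -(lam i) ^ 2 := fun i => by
      have h4 : lam i * v i ≤ 0 := by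
        rcases (hgx i).lt_or_eq with hi | hi
        · simp [hwc i hi]
        · exact mul_nonpos_of_nonneg_of_nonpos (hwg i) (hv i hi)
      rw [show ∑ j, gJac i j * d j = -lam i + v i by linarith [hvg i]]
      linarith
    have h5 := sum_le_sum fun i (_ : i ∈ univ) => h3 i
    simp only [← h0, zero_mul, hvh, h2, mul_neg, ← sq, sum_neg_distrib] at h1 h5
    have s1 : 0 ≤ ∑ i, lam i ^ 2 := by positivity
    have s2 : 0 ≤ ∑ i, mu (.inl i) ^ 2 := by positivity
    have s3 : 0 ≤ ∑ j : (J \ Jstar : Finset (Fin n)), mu (.inr j) ^ 2 := by positivity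
    have e1 : ∑ i, lam i ^ 2 = 0 := by linarith
    have e2 : ∑ i, mu (.inl i) ^ 2 = 0 := by linarith
    have e3 : ∑ j : (J \ Jstar : Finset (Fin n)), mu (.inr j) ^ 2 = 0 := by linarith
    rw [sum_eq_zero_iff_of_nonneg fun _ _ => sq_nonneg _] at e1 e2 e3
    refine Prod.ext h0.symm (Prod.ext (funext fun i => ?_) (funext fun j => ?_))
    · simpa using e1 i (mem_univ i)
    · rcases j with j | j
      · simpa using e2 j (mem_univ j)
      · simpa using e3 j (mem_univ j)
  refine ⟨fun i => w0⁻¹ * lam i, fun i => w0⁻¹ * mu (.inl i),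
    fun j => if hj : j ∈ J \ Jstar then w0⁻¹ * mu (.inr ⟨j, hj⟩) else 0, ?_, ?_, ?_⟩
  · intro x hx
    have h1 := mul_nonneg (inv_nonneg.2 hw0) (hwX x hx)
    have h2 : ∑ j, (if hj : j ∈ J \ Jstar then w0⁻¹ * mu (.inr ⟨j, hj⟩) else 0) * (x j - xs j) =
        ∑ j : (J \ Jstar : Finset (Fin n)), w0⁻¹ * mu (.inr j) * (x j - xs j) := by
      rw [← sum_subset (subset_univ (J \ Jstar)) fun j _ hj => by rw [dif_neg hj, zero_mul],
        ← sum_coe_sort]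
      exact sum_congr rfl fun j _ => by rw [dif_pos j.2]
    have h3 : ∀ {q : ℕ} (a : Fin q → ℝ) (A : Fin q → Fin n → ℝ),
        ∑ j, (∑ i, w0⁻¹ * a i * A i j) * (x j - xs j) =
          w0⁻¹ * ∑ i, a i * ∑ j, A i j * (x j - xs j) := by
      intro q a A
      simp only [sum_mul, mul_sum]
      rw [sum_comm]
      simp only [mul_assoc]
    have h4 : ∑ j, fgrad j * (x j - xs j) = w0⁻¹ * (w0 * ∑ j, fgrad j * (x j - xs j)) := by
      rw [inv_mul_cancel_left₀ hw0'.ne']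
    have h5 : ∀ (a b c e : Fin n → ℝ), ∑ j, (-a j - b j - c j - e j) * (x j - xs j) =
        -(∑ j, a j * (x j - xs j) + ∑ j, b j * (x j - xs j) + (∑ j, c j * (x j - xs j)
          + ∑ j, e j * (x j - xs j))) := by
      intro a b c e
      simp only [← sum_add_distrib, ← sum_neg_distrib]
      exact sum_congr rfl fun j _ => by ring
    rw [h5, h2, h3, h3, h4, Left.neg_nonpos_iff]
    refine h1.trans_eq ?_
    simp only [mul_add, mul_assoc, mul_sum]
  · intro i
    refine ⟨mul_nonneg (inv_nonneg.2 hw0) (hwg i), ?_⟩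
    rcases (hgx i).lt_or_eq with hi | hi
    · simp [hwc i hi]
    · simp [hi]
  · intro j hj
    exact dif_neg hj
end

section
/- Assume f, g and h are continuous, and let Υ ∈ ℝ. Let {ρ_k} be a sequence of positive numbers with ρ_k → ∞, and let {(x^k, y^k)} be a sequence with x^k ∈ X, y^k ∈ Y, and f(x^k) + (ρ_k/2)(‖max(g(x^k), 0)‖² + ‖h(x^k)‖² + ‖x^k_J − y^k‖²) ≤ Υ for all k. Suppose the level set X_Υ = {x ∈ X : f(x) ≤ Υ} is compact and (x*, y*) is an accumulation point of {(x^k, y^k)}. Then x*_J = y*, and x* is a feasible point of the problem (P1): x* ∈ X, g(x*) ≤ 0 componentwise, h(x*) = 0, and ‖x*_J‖₀ ≤ r. -/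
open Finset Filter

/-- The set of vectors with at most `r` nonzero entries is closed. -/
theorem isClosed_setOf_card_support_le {ι : Type*} [Fintype ι] (r : ℕ) :
    IsClosed {y : ι → ℝ | (univ.filter fun j => y j ≠ 0).card ≤ r} := by
  rw [← isOpen_compl_iff, isOpen_iff_mem_nhds]
  intro y hy
  have hev : ∀ᶠ z in nhds y, ∀ j, y j ≠ 0 → z j ≠ 0 := by
    refine eventually_all.2 fun j => ?_
    by_cases hj : y j = 0
    · simp [hj]
    · filter_upwards [(continuous_apply j).continuousAt.eventually_ne hj] with z hz _
      exact hz
  filter_upwards [hev] with z hz hzr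
  refine hy (le_trans (card_le_card fun j hj => ?_) hzr)
  simp only [mem_filter, mem_univ, true_and] at hj ⊢
  exact hz j hj

/-- If `a k + ρ k / 2 * b k` is bounded above, `a` and `b` converge and `ρ → ∞`, then the limit
of `b` is nonpositive. -/
theorem nonpos_of_tendsto_of_penalty_le {a b ρ : ℕ → ℝ} {A B C : ℝ}
    (hρ : Tendsto ρ atTop atTop) (ha : Tendsto a atTop (nhds A)) (hb : Tendsto b atTop (nhds B))
    (hle : ∀ k, a k + ρ k / 2 * b k ≤ C) : B ≤ 0 := by
  by_contra! hB
  have hlim : Tendsto (fun k => a k + ρ k / 2 * b k) atTop atTop :=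
    ha.add_atTop ((hρ.atTop_div_const two_pos).atTop_mul_pos hB hb)
  obtain ⟨k, hk⟩ := (hlim.eventually_gt_atTop C).exists
  exact (hle k).not_gt hk

/-- Feasibility of accumulation points of the penalty decomposition method for (P1):
if `ρ_k → ∞`, `q_{ρ_k}(x^k, y^k) ≤ Υ`, and the level set `X_Υ` is compact, then any
accumulation point `(x*, y*)` satisfies `x*_J = y*` and `x*` is feasible for (P1). -/
theorem pd_accumulation_point_feasible_P1
    {n m p : ℕ} (X : Set (Fin n → ℝ)) (hXclosed : IsClosed X) (hXconv : Convex ℝ X)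
    (f : (Fin n → ℝ) → ℝ) (g : (Fin n → ℝ) → Fin m → ℝ) (h : (Fin n → ℝ) → Fin p → ℝ)
    (hf : Continuous f) (hg : Continuous g) (hh : Continuous h)
    (J : Finset (Fin n)) (r : ℕ) (hr : r ≤ J.card)
    (Υ : ℝ) (ρ : ℕ → ℝ) (hρpos : ∀ k, 0 < ρ k) (hρ : Tendsto ρ atTop atTop)
    (xseq : ℕ → Fin n → ℝ) (yseq : ℕ → {j // j ∈ J} → ℝ)
    (hmem : ∀ k, xseq k ∈ X ∧ (univ.filter fun j => yseq k j ≠ 0).card ≤ r)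
    (hbound : ∀ k,
      f (xseq k) + ρ k / 2 * ((∑ i, max (g (xseq k) i) 0 ^ 2) + (∑ j, h (xseq k) j ^ 2) +
        ∑ j : {j // j ∈ J}, (xseq k j.1 - yseq k j) ^ 2) ≤ Υ)
    (hcompact : IsCompact {x | x ∈ X ∧ f x ≤ Υ})
    -- (x*, y*) is an accumulation point of the sequence
    (xs : Fin n → ℝ) (ys : {j // j ∈ J} → ℝ)
    (hacc : ∃ φ : ℕ → ℕ, StrictMono φ ∧
      Tendsto (fun k => (xseq (φ k), yseq (φ k))) atTop (nhds (xs, ys))) :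
    -- then x*_J = y* and x* is feasible for (P1)
    (∀ j : {j // j ∈ J}, xs j.1 = ys j) ∧
    xs ∈ X ∧ (∀ i, g xs i ≤ 0) ∧ (∀ j, h xs j = 0) ∧
      (J.filter fun j => xs j ≠ 0).card ≤ r := by
  obtain ⟨φ, hφ, hlim⟩ := hacc
  have hx : Tendsto (fun k => xseq (φ k)) atTop (nhds xs) := hlim.fst_nhds
  have hy : Tendsto (fun k => yseq (φ k)) atTop (nhds ys) := hlim.snd_nhds
  have hpen : Continuous fun z : (Fin n → ℝ) × ({j // j ∈ J} → ℝ) =>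
      (∑ i, max (g z.1 i) 0 ^ 2) + (∑ j, h z.1 j ^ 2) +
        ∑ j : {j // j ∈ J}, (z.1 j.1 - z.2 j) ^ 2 := by fun_prop
  have hle := nonpos_of_tendsto_of_penalty_le (hρ.comp hφ.tendsto_atTop)
    ((hf.tendsto xs).comp hx) ((hpen.tendsto (xs, ys)).comp hlim) fun k => hbound (φ k)
  dsimp only at hle
  have hg0 : 0 ≤ ∑ i, max (g xs i) 0 ^ 2 := sum_nonneg fun _ _ => sq_nonneg _
  have hh0 : 0 ≤ ∑ j, h xs j ^ 2 := sum_nonneg fun _ _ => sq_nonneg _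
  have hJ0 : 0 ≤ ∑ j : {j // j ∈ J}, (xs j.1 - ys j) ^ 2 := sum_nonneg fun _ _ => sq_nonneg _
  have hgz := (sum_eq_zero_iff_of_nonneg fun _ _ => sq_nonneg _).1
    (show ∑ i, max (g xs i) 0 ^ 2 = 0 by linarith)
  have hhz := (sum_eq_zero_iff_of_nonneg fun _ _ => sq_nonneg _).1
    (show ∑ j, h xs j ^ 2 = 0 by linarith)
  have hJz := (sum_eq_zero_iff_of_nonneg fun _ _ => sq_nonneg _).1
    (show ∑ j : {j // j ∈ J}, (xs j.1 - ys j) ^ 2 = 0 by linarith)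
  have hxy : ∀ j : {j // j ∈ J}, xs j.1 = ys j := fun j =>
    sub_eq_zero.1 (pow_eq_zero_iff two_ne_zero |>.1 (hJz j (mem_univ j)))
  refine ⟨hxy, hXclosed.mem_of_tendsto hx (.of_forall fun k => (hmem (φ k)).1), fun i => ?_,
    fun j => pow_eq_zero_iff two_ne_zero |>.1 (hhz j (mem_univ j)), ?_⟩
  · exact max_eq_right_iff.1 (pow_eq_zero_iff two_ne_zero |>.1 (hgz i (mem_univ i)))
  · have hys : (univ.filter fun j => ys j ≠ 0).card ≤ r :=
      (isClosed_setOf_card_support_le r).mem_of_tendsto hy (.of_forall fun k => (hmem (φ k)).2)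
    refine le_trans (card_le_card_of_surjOn Subtype.val fun j hj => ?_) hys
    obtain ⟨hjJ, hj⟩ := mem_filter.1 (mem_coe.1 hj)
    exact ⟨⟨j, hjJ⟩, by simpa [← hxy] using hj, rfl⟩
end

section
/- Assume each component h_j of h is an affine function, f and each component g_i of g are convex and continuously differentiable, and let ν ≥ 0 and ρ > 0. Let {(x^l, y^l)}_{l ≥ 0} be a sequence generated by the block coordinate descent method: for each l, x^{l+1} ∈ X minimizes p_ρ(·, y^l) over X and y^{l+1} ∈ ℝ^J minimizes p_ρ(x^{l+1}, ·) over ℝ^J. Then any accumulation point (x*, y*) of {(x^l, y^l)} is a local minimizer of p_ρ over X × ℝ^J: there exists ε > 0 such that p_ρ(x, y) ≥ p_ρ(x*, y*) for all x ∈ X and y ∈ ℝ^J with ‖(x, y) − (x*, y*)‖ < ε. -/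
open Finset Filter

/-- The penalty function `p_ρ(x,y) = f(x) + ν‖y‖₀ + (ρ/2)(‖max(g(x),0)‖² + ‖h(x)‖²
+ ‖x_J − y‖²)` associated with problem (P2). -/
noncomputable def pPen {n m p : ℕ} (J : Finset (Fin n))
    (f : (Fin n → ℝ) → ℝ) (g : (Fin n → ℝ) → Fin m → ℝ) (h : (Fin n → ℝ) → Fin p → ℝ)
    (ν ρ : ℝ) (x : Fin n → ℝ) (y : {j // j ∈ J} → ℝ) : ℝ :=
  f x + ν * ((univ.filter fun j => y j ≠ 0).card : ℝ) +
    ρ / 2 * ((∑ i, max (g x i) 0 ^ 2) + (∑ j, h x j ^ 2) +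
      ∑ j : {j // j ∈ J}, (x j.1 - y j) ^ 2)

/-- The number of nonzero entries of a vector. -/
noncomputable def numNonzero {ι : Type*} [Fintype ι] (y : ι → ℝ) : ℝ :=
  ((univ.filter fun j => y j ≠ 0).card : ℝ)

/-- The part of the penalty function which depends on `x` alone. -/
noncomputable def penX {n m p : ℕ}
    (f : (Fin n → ℝ) → ℝ) (g : (Fin n → ℝ) → Fin m → ℝ) (h : (Fin n → ℝ) → Fin p → ℝ)
    (ρ : ℝ) (x : Fin n → ℝ) : ℝ :=
  f x + ρ / 2 * ((∑ i, max (g x i) 0 ^ 2) + ∑ j, h x j ^ 2)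

/-- The penalty function without its cardinality term, for a general `x`-part `F`. -/
noncomputable def smoothPen {n : ℕ} (J : Finset (Fin n)) (F : (Fin n → ℝ) → ℝ) (ρ : ℝ)
    (x : Fin n → ℝ) (y : {j // j ∈ J} → ℝ) : ℝ :=
  F x + ρ / 2 * ∑ j : {j // j ∈ J}, (x j.1 - y j) ^ 2

lemma pPen_eq {n m p : ℕ} (J : Finset (Fin n))
    (f : (Fin n → ℝ) → ℝ) (g : (Fin n → ℝ) → Fin m → ℝ) (h : (Fin n → ℝ) → Fin p → ℝ)
    (ν ρ : ℝ) (x : Fin n → ℝ) (y : {j // j ∈ J} → ℝ) :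
    pPen J f g h ν ρ x y = smoothPen J (penX f g h ρ) ρ x y + ν * numNonzero y := by
  unfold pPen smoothPen penX numNonzero
  ring

lemma numNonzero_le_of_support {ι : Type*} [Fintype ι] {y z : ι → ℝ}
    (hyz : ∀ j, y j ≠ 0 → z j ≠ 0) : numNonzero y ≤ numNonzero z := by
  unfold numNonzero
  exact_mod_cast card_le_card fun j hj => by simpa using hyz j (by simpa using hj)

lemma numNonzero_add_one_le_of_support {ι : Type*} [Fintype ι] {y z : ι → ℝ}
    (hyz : ∀ j, y j ≠ 0 → z j ≠ 0) {j : ι} (hyj : y j = 0) (hzj : z j ≠ 0) :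
    numNonzero y + 1 ≤ numNonzero z := by
  unfold numNonzero
  have hlt : (univ.filter fun j => y j ≠ 0) ⊂ univ.filter fun j => z j ≠ 0 := by
    refine (ssubset_iff_of_subset fun i hi => ?_).2 ⟨j, by simpa using hzj, by simpa using hyj⟩
    simpa using hyz i (by simpa using hi)
  exact_mod_cast card_lt_card hlt

lemma eventually_support_subset {ι : Type*} [Finite ι] (ys : ι → ℝ) :
    ∀ᶠ y in nhds ys, ∀ j, ys j ≠ 0 → y j ≠ 0 := by
  refine eventually_all.2 fun j => ?_
  by_cases hj : ys j = 0
  · simp [hj]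
  · filter_upwards [(continuous_apply j).continuousAt.eventually_ne hj] with y hy _ using hy

lemma convexOn_penX {n m p : ℕ}
    {f : (Fin n → ℝ) → ℝ} {g : (Fin n → ℝ) → Fin m → ℝ} {h : (Fin n → ℝ) → Fin p → ℝ}
    (hf : ConvexOn ℝ Set.univ f) (hg : ∀ i, ConvexOn ℝ Set.univ fun x => g x i)
    (hh : ∀ j, ∃ (w : Fin n → ℝ) (b : ℝ), ∀ x, h x j = (∑ i, w i * x i) + b)
    {ρ : ℝ} (hρ : 0 ≤ ρ) : ConvexOn ℝ Set.univ (penX f g h ρ) := by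
  have hgsq (i : Fin m) : ConvexOn ℝ Set.univ fun x => max (g x i) 0 ^ 2 :=
    ((hg i).sup (convexOn_const 0 convex_univ)).pow (fun _ _ => le_max_right _ _) 2
  have hhsq (j : Fin p) : ConvexOn ℝ Set.univ fun x => h x j ^ 2 := by
    obtain ⟨w, b, hwb⟩ := hh j
    refine ⟨convex_univ, fun x _ y _ s t hs ht hst => ?_⟩
    have hxy : h (s • x + t • y) j = s * h x j + t * h y j := by
      simp only [hwb, Pi.add_apply, Pi.smul_apply, smul_eq_mul, mul_add, sum_add_distrib, mul_sum]
      simp only [mul_left_comm]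
      linear_combination (-b) * hst
    simp only [hxy]
    exact even_two.convexOn_pow.2 (Set.mem_univ _) (Set.mem_univ _) hs ht hst
  have hsum {k : ℕ} {u : (Fin n → ℝ) → Fin k → ℝ}
      (hu : ∀ i, ConvexOn ℝ Set.univ fun x => u x i) :
      ConvexOn ℝ Set.univ fun x => ∑ i, u x i := by
    refine ⟨convex_univ, fun x hx y hy s t hs ht hst => ?_⟩
    simp only [smul_eq_mul, mul_sum, ← sum_add_distrib]
    exact sum_le_sum fun i _ => (hu i).2 hx hy hs ht hst
  exact hf.add (((hsum hgsq).add (hsum hhsq)).smul (by positivity : 0 ≤ ρ / 2))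

lemma continuous_penX {n m p : ℕ}
    {f : (Fin n → ℝ) → ℝ} {g : (Fin n → ℝ) → Fin m → ℝ} {h : (Fin n → ℝ) → Fin p → ℝ}
    (hf : Continuous f) (hg : ∀ i, Continuous fun x => g x i)
    (hh : ∀ j, Continuous fun x => h x j) (ρ : ℝ) : Continuous (penX f g h ρ) := by
  unfold penX
  fun_prop

lemma continuous_smoothPen {n : ℕ} (J : Finset (Fin n)) {F : (Fin n → ℝ) → ℝ}
    (hF : Continuous F) (ρ : ℝ) :
    Continuous fun z : (Fin n → ℝ) × ({j // j ∈ J} → ℝ) => smoothPen J F ρ z.1 z.2 := by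
  unfold smoothPen
  fun_prop

/-- If `a ≤ b + C t` for all `t ∈ (0, 1]`, then `a ≤ b`. -/
lemma le_of_forall_le_add_mul {a b C : ℝ}
    (hab : ∀ t : ℝ, 0 < t → t ≤ 1 → a ≤ b + C * t) : a ≤ b := by
  have hlim : Tendsto (fun t : ℝ => b + C * t) (nhdsWithin 0 (Set.Ioi 0)) (nhds b) := by
    have hc : Continuous fun t : ℝ => b + C * t := by fun_prop
    simpa using (hc.tendsto 0).mono_left nhdsWithin_le_nhds
  refine ge_of_tendsto hlim ?_
  filter_upwards [Ioc_mem_nhdsGT (zero_lt_one' ℝ)] with t ht using hab t ht.1 ht.2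

/-- A blockwise minimizer whose `y`-block agrees with `x_J` outside its zeros is a global
minimizer among the `y` vanishing wherever `y*` differs from `x*_J`. -/
lemma smoothPen_le_of_blockwise {n : ℕ} {X : Set (Fin n → ℝ)} (hX : Convex ℝ X)
    {J : Finset (Fin n)} {F : (Fin n → ℝ) → ℝ} (hF : ConvexOn ℝ Set.univ F)
    {ρ : ℝ} (hρ : 0 ≤ ρ) {xs : Fin n → ℝ} {ys : {j // j ∈ J} → ℝ} (hxs : xs ∈ X)
    (hmin : ∀ x ∈ X, smoothPen J F ρ xs ys ≤ smoothPen J F ρ x ys)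
    {S : Set {j // j ∈ J}} (hS : ∀ j ∈ S, ys j = xs j.1) (hS' : ∀ j ∉ S, ys j = 0)
    {x : Fin n → ℝ} (hx : x ∈ X) {y : {j // j ∈ J} → ℝ} (hy : ∀ j ∉ S, y j = 0) :
    smoothPen J F ρ xs ys ≤ smoothPen J F ρ x y := by
  set D : ℝ := ∑ j : {j // j ∈ J}, (x j.1 - xs j.1) ^ 2
  refine le_of_forall_le_add_mul (C := ρ / 2 * D) fun t ht ht1 => ?_
  have hconv := hF.2 (Set.mem_univ xs) (Set.mem_univ x) (sub_nonneg.2 ht1) ht.le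
    (sub_add_cancel 1 t)
  have hle := hmin _ (hX hxs hx (sub_nonneg.2 ht1) ht.le (sub_add_cancel 1 t))
  have hsq : ∑ j : {j // j ∈ J}, (((1 - t) • xs + t • x) j.1 - ys j) ^ 2 ≤
      (1 - t) * ∑ j : {j // j ∈ J}, (xs j.1 - ys j) ^ 2 +
        t * ∑ j : {j // j ∈ J}, (x j.1 - y j) ^ 2 + t ^ 2 * D := by
    simp only [D, mul_sum, ← sum_add_distrib]
    refine sum_le_sum fun j _ => ?_
    simp only [Pi.add_apply, Pi.smul_apply, smul_eq_mul]
    by_cases hj : j ∈ S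
    · rw [hS j hj]
      nlinarith [mul_nonneg ht.le (sq_nonneg (x j.1 - y j))]
    · rw [hS' j hj, hy j hj]
      nlinarith [mul_nonneg (mul_nonneg ht.le (sub_nonneg.2 ht1)) (sq_nonneg (x j.1 - xs j.1)),
        mul_nonneg (sq_nonneg t) (sq_nonneg (x j.1 - xs j.1))]
  have hsq' := mul_le_mul_of_nonneg_left hsq (by positivity : 0 ≤ ρ / 2)
  unfold smoothPen at hle ⊢
  simp only [smul_eq_mul] at hconv
  refine le_of_mul_le_mul_left ?_ ht
  linarith

/-- If `y*` minimizes the penalty function for fixed `x*`, then `y*_j = x*_j` whenever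
`y*_j ≠ 0` or the cardinality term is absent. -/
lemma eq_of_forall_smoothPen_le {n : ℕ} {J : Finset (Fin n)} {F : (Fin n → ℝ) → ℝ}
    {ν ρ : ℝ} (hν : 0 ≤ ν) (hρ : 0 < ρ) {xs : Fin n → ℝ} {ys : {j // j ∈ J} → ℝ}
    (hmin : ∀ y, smoothPen J F ρ xs ys + ν * numNonzero ys ≤
      smoothPen J F ρ xs y + ν * numNonzero y)
    {j : {j // j ∈ J}} (hj : ν = 0 ∨ ys j ≠ 0) : ys j = xs j.1 := by
  classical
  have hle := hmin (Function.update ys j (xs j.1))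
  have hcard : ν * numNonzero (Function.update ys j (xs j.1)) ≤ ν * numNonzero ys := by
    rcases hj with hν0 | hj
    · simp [hν0]
    · refine mul_le_mul_of_nonneg_left (numNonzero_le_of_support fun i hi => ?_) hν
      rcases eq_or_ne i j with rfl | hij
      · exact hj
      · simpa [hij] using hi
  have hsum : ∑ i : {j // j ∈ J}, (xs i.1 - Function.update ys j (xs j.1) i) ^ 2 +
      (xs j.1 - ys j) ^ 2 = ∑ i : {j // j ∈ J}, (xs i.1 - ys i) ^ 2 := by
    rw [← add_sum_erase univ (fun i : {j // j ∈ J} => (xs i.1 - ys i) ^ 2) (mem_univ j),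
      ← add_sum_erase univ _ (mem_univ j)]
    have herase : ∑ i ∈ univ.erase j, (xs i.1 - Function.update ys j (xs j.1) i) ^ 2 =
        ∑ i ∈ univ.erase j, (xs i.1 - ys i) ^ 2 :=
      sum_congr rfl fun i hi => by rw [Function.update_of_ne (ne_of_mem_erase hi)]
    rw [herase, Function.update_self]
    ring
  unfold smoothPen at hle
  rw [← hsum] at hle
  have hsq : (xs j.1 - ys j) ^ 2 ≤ 0 := by
    by_contra! hpos
    have := mul_pos hρ hpos
    linarith
  linarith [pow_eq_zero_iff two_ne_zero |>.1 (le_antisymm hsq (sq_nonneg _))]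

/-- Blockwise minimizers of the penalty function are local minimizers. -/
lemma eventually_le_of_blockwise {n : ℕ} {X : Set (Fin n → ℝ)} (hX : Convex ℝ X)
    {J : Finset (Fin n)} {F : (Fin n → ℝ) → ℝ} (hF : ConvexOn ℝ Set.univ F)
    (hFc : Continuous F) {ν ρ : ℝ} (hν : 0 ≤ ν) (hρ : 0 < ρ)
    {xs : Fin n → ℝ} {ys : {j // j ∈ J} → ℝ} (hxs : xs ∈ X)
    (hminx : ∀ x ∈ X, smoothPen J F ρ xs ys ≤ smoothPen J F ρ x ys)
    (hminy : ∀ y, smoothPen J F ρ xs ys + ν * numNonzero ys ≤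
      smoothPen J F ρ xs y + ν * numNonzero y) :
    ∀ᶠ z in nhds (xs, ys), z.1 ∈ X → smoothPen J F ρ xs ys + ν * numNonzero ys ≤
      smoothPen J F ρ z.1 z.2 + ν * numNonzero z.2 := by
  have hnear : ∀ᶠ z in nhds (xs, ys),
      0 < ν → smoothPen J F ρ xs ys - ν < smoothPen J F ρ z.1 z.2 := by
    by_cases hν0 : 0 < ν
    · filter_upwards [((continuous_smoothPen J hFc ρ).tendsto (xs, ys)).eventually_const_lt
        (sub_lt_self _ hν0)] with z hz _ using hz
    · simp [hν0]
  filter_upwards [hnear, (continuous_snd.tendsto (xs, ys)).eventually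
    (eventually_support_subset ys)] with z hz hsupp hzX
  by_cases hzero : ∀ j, ¬ (ν = 0 ∨ ys j ≠ 0) → z.2 j = 0
  · have hq := smoothPen_le_of_blockwise hX hF hρ.le hxs hminx
      (S := {j | ν = 0 ∨ ys j ≠ 0}) (fun j hj => eq_of_forall_smoothPen_le hν hρ hminy hj)
      (fun j hj => by_contra fun hne => hj (Or.inr hne)) hzX hzero
    exact add_le_add hq (mul_le_mul_of_nonneg_left (numNonzero_le_of_support hsupp) hν)
  · push Not at hzero
    obtain ⟨j, ⟨hν0, hyj⟩, hzj⟩ := hzero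
    have hcard := mul_le_mul_of_nonneg_left
      (numNonzero_add_one_le_of_support hsupp hyj hzj) hν
    linarith [hz (hν.lt_of_ne' hν0)]

/-- When `h` is affine and `f`, `g` are convex and continuously differentiable, any
accumulation point of the sequence generated by the block coordinate descent method for
`min p_ρ(x,y)` over `X × ℝ^J` is a local minimizer of this problem. -/
theorem bcd_accumulation_point_is_local_min_pPen
    {n m p : ℕ} (X : Set (Fin n → ℝ)) (hXclosed : IsClosed X) (hXconv : Convex ℝ X)
    (f : (Fin n → ℝ) → ℝ) (g : (Fin n → ℝ) → Fin m → ℝ) (h : (Fin n → ℝ) → Fin p → ℝ)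
    (hf : ContDiff ℝ 1 f) (hg : ∀ i, ContDiff ℝ 1 fun x => g x i)
    (hh : ∀ j, ContDiff ℝ 1 fun x => h x j)
    -- h affine, f and g convex
    (hhaff : ∀ j, ∃ (w : Fin n → ℝ) (b : ℝ), ∀ x, h x j = (∑ i, w i * x i) + b)
    (hfconv : ConvexOn ℝ Set.univ f) (hgconv : ∀ i, ConvexOn ℝ Set.univ fun x => g x i)
    (J : Finset (Fin n)) (ν : ℝ) (hν : 0 ≤ ν) (ρ : ℝ) (hρ : 0 < ρ)
    -- the BCD sequence
    (xseq : ℕ → Fin n → ℝ) (yseq : ℕ → {j // j ∈ J} → ℝ)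
    (hmem : ∀ l, xseq l ∈ X)
    (hxstep : ∀ l, ∀ x ∈ X,
      pPen J f g h ν ρ (xseq (l + 1)) (yseq l) ≤ pPen J f g h ν ρ x (yseq l))
    (hystep : ∀ l, ∀ y : {j // j ∈ J} → ℝ,
      pPen J f g h ν ρ (xseq (l + 1)) (yseq (l + 1)) ≤ pPen J f g h ν ρ (xseq (l + 1)) y)
    -- (x*, y*) is an accumulation point of the sequence
    (xs : Fin n → ℝ) (ys : {j // j ∈ J} → ℝ)
    (hacc : ∃ φ : ℕ → ℕ, StrictMono φ ∧
      Tendsto (fun l => (xseq (φ l), yseq (φ l))) atTop (nhds (xs, ys))) :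
    -- then (x*, y*) is a local minimizer of p_ρ over X × ℝ^J
    ∃ ε > 0, ∀ x ∈ X, ∀ y : {j // j ∈ J} → ℝ,
      ‖(x, y) - (xs, ys)‖ < ε → pPen J f g h ν ρ xs ys ≤ pPen J f g h ν ρ x y := by
  set F := penX f g h ρ
  have hFconv : ConvexOn ℝ Set.univ F := convexOn_penX hfconv hgconv hhaff hρ.le
  have hFcont : Continuous F := continuous_penX hf.continuous (fun i => (hg i).continuous)
    (fun j => (hh j).continuous) ρ
  simp only [pPen_eq] at hxstep hystep ⊢
  obtain ⟨φ, hφ, hlim⟩ := hacc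
  have hlimx : Tendsto (fun l => xseq (φ l)) atTop (nhds xs) := hlim.fst_nhds
  have hlimy : Tendsto (fun l => yseq (φ l)) atTop (nhds ys) := hlim.snd_nhds
  have hxs : xs ∈ X := hXclosed.mem_of_tendsto hlimx (Eventually.of_forall fun l => hmem _)
  have hQlim {x : ℕ → Fin n → ℝ} {y : ℕ → {j // j ∈ J} → ℝ} {a : Fin n → ℝ}
      {b : {j // j ∈ J} → ℝ} (hx : Tendsto x atTop (nhds a)) (hy : Tendsto y atTop (nhds b)) :
      Tendsto (fun l => smoothPen J F ρ (x l) (y l)) atTop (nhds (smoothPen J F ρ a b)) :=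
    ((continuous_smoothPen J hFcont ρ).tendsto (a, b)).comp (hx.prodMk_nhds hy)
  have hqlim := hQlim hlimx hlimy
  let P : ℕ → ℝ := fun l => smoothPen J F ρ (xseq l) (yseq l) + ν * numNonzero (yseq l)
  have hanti : Antitone P := antitone_nat_of_succ_le fun l =>
    (hystep l (yseq l)).trans (hxstep l _ (hmem l))
  have hcard_nonneg (y : {j // j ∈ J} → ℝ) : 0 ≤ ν * numNonzero y :=
    mul_nonneg hν (Nat.cast_nonneg _)
  obtain ⟨c, hc⟩ : ∃ c, Tendsto (P ∘ φ) atTop (nhds c) := by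
    obtain ⟨b, hb⟩ := hqlim.bddBelow_range
    refine ⟨_, tendsto_atTop_ciInf (hanti.comp_monotone hφ.monotone) ⟨b, ?_⟩⟩
    rintro _ ⟨l, rfl⟩
    exact (hb ⟨l, rfl⟩).trans (le_add_of_nonneg_right (hcard_nonneg _))
  have hκ : Tendsto (fun l => ν * numNonzero (yseq (φ l))) atTop
      (nhds (c - smoothPen J F ρ xs ys)) := by
    simpa [P] using hc.sub hqlim
  have hminx : ∀ x ∈ X, smoothPen J F ρ xs ys ≤ smoothPen J F ρ x ys := by
    intro x hx
    have hle := le_of_tendsto_of_tendsto' (hc.comp (tendsto_add_atTop_nat 1))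
      ((hQlim (tendsto_const_nhds (x := x)) hlimy).add hκ) fun l =>
        (hanti (Nat.succ_le_of_lt (hφ l.lt_succ_self))).trans
          ((hystep (φ l) (yseq (φ l))).trans (hxstep (φ l) x hx))
    linarith
  have hminy : ∀ y, smoothPen J F ρ xs ys + ν * numNonzero ys ≤
      smoothPen J F ρ xs y + ν * numNonzero y := by
    intro y
    refine le_of_tendsto_of_tendsto (hqlim.add_const (ν * numNonzero ys))
      ((hQlim hlimx (tendsto_const_nhds (x := y))).add_const _) ?_
    filter_upwards [hlimy.eventually (eventually_support_subset ys), eventually_ge_atTop 1]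
      with l hsupp hl
    obtain ⟨k, hk⟩ := Nat.exists_eq_add_of_le' (hl.trans hφ.le_apply)
    have hy := hystep k y
    rw [← hk] at hy
    linarith [mul_le_mul_of_nonneg_left (numNonzero_le_of_support hsupp) hν]
  obtain ⟨ε, hε, hball⟩ := Metric.eventually_nhds_iff.1
    (eventually_le_of_blockwise hXconv hFconv hFcont hν hρ hxs hminx hminy)
  exact ⟨ε, hε, fun x hx y hxy => hball (y := (x, y)) (by rwa [dist_eq_norm]) hx⟩
end
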